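/- arXiv:2410.10737 — 3 statements merged into one kernel-verified Lean document; each statement's English description precedes it below -/
import Mathlib

section
/- Let S and A be finite nonempty sets with D = |S|·|A|, let γ ∈ [0,1), let P(·|s,a) be a probability distribution on S for each (s,a) ∈ S×A, let R : S×A → ℝ, and for Q : S×A → ℝ define M(Q)(s,a) = ∑_{s'∈S} P(s'|s,a) · max_{a'∈A} Q(s',a') and H(Q) = Q − R − γ·M(Q). Suppose Q* : S×A → ℝ satisfies H(Q*) = 0. Then for every Q : S×A → ℝ, the Euclidean inner product satisfies ⟨Q − Q*, H(Q)⟩ ≥ ‖Q − Q*‖₂² − γ·‖Q − Q*‖₁·‖Q − Q*‖_∞; in particular, if γ·√D < 1, then ⟨Q − Q*, H(Q)⟩ ≥ (1 − γ·√D)·‖Q − Q*‖₂². -/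
open Finset

/-- Lemma A.1: coercivity of the expected Bellman error operator of tabular
Q-learning. -/
theorem stmt_0 {S A : Type*} [Fintype S] [Fintype A] [Nonempty S] [Nonempty A]
    (γ : ℝ) (hγ0 : 0 ≤ γ) (hγ1 : γ < 1)
    (P : S × A → S → ℝ) (hP0 : ∀ p s', 0 ≤ P p s') (hP1 : ∀ p, ∑ s', P p s' = 1)
    (R : S × A → ℝ)
    (M : (S × A → ℝ) → (S × A → ℝ))
    (hM : ∀ Q p, M Q p = ∑ s', P p s' *
      (univ.sup' univ_nonempty fun a' => Q (s', a')))
    (H : (S × A → ℝ) → (S × A → ℝ))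
    (hH : ∀ Q p, H Q p = Q p - R p - γ * M Q p)
    (Qstar : S × A → ℝ) (hQstar : H Qstar = 0) :
    (∀ Q : S × A → ℝ,
      ∑ p, (Q p - Qstar p) * H Q p ≥
        (∑ p, (Q p - Qstar p) ^ 2)
          - γ * (∑ p, |Q p - Qstar p|)
            * (univ.sup' univ_nonempty fun p => |Q p - Qstar p|)) ∧
    (γ * Real.sqrt (Fintype.card S * Fintype.card A) < 1 →
      ∀ Q : S × A → ℝ,
        ∑ p, (Q p - Qstar p) * H Q p ≥
          (1 - γ * Real.sqrt (Fintype.card S * Fintype.card A))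
            * ∑ p, (Q p - Qstar p) ^ 2) := by
  have key : ∀ Q : S × A → ℝ,
      ∑ p, (Q p - Qstar p) * H Q p ≥
        (∑ p, (Q p - Qstar p) ^ 2)
          - γ * (∑ p, |Q p - Qstar p|)
            * (univ.sup' univ_nonempty fun p => |Q p - Qstar p|) := by
    intro Q
    set N := univ.sup' univ_nonempty fun p => |Q p - Qstar p| with hN
    have hle : ∀ p, |Q p - Qstar p| ≤ N := fun p =>
      Finset.le_sup' (fun p => |Q p - Qstar p|) (mem_univ p)
    have hsup : ∀ s', |(univ.sup' univ_nonempty fun a' => Q (s', a')) -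
        (univ.sup' univ_nonempty fun a' => Qstar (s', a'))| ≤ N := by
      intro s'
      have h1 : (univ.sup' univ_nonempty fun a' => Q (s', a')) ≤
          (univ.sup' univ_nonempty fun a' => Qstar (s', a')) + N := by
        apply Finset.sup'_le
        intro a _
        have h2 := Finset.le_sup' (fun a' => Qstar (s', a')) (mem_univ a)
        have h3 := abs_le.1 (hle (s', a))
        linarith [h3.2]
      have h1' : (univ.sup' univ_nonempty fun a' => Qstar (s', a')) ≤
          (univ.sup' univ_nonempty fun a' => Q (s', a')) + N := by
        apply Finset.sup'_le
        intro a _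
        have h2 := Finset.le_sup' (fun a' => Q (s', a')) (mem_univ a)
        have h3 := abs_le.1 (hle (s', a))
        linarith [h3.1]
      rw [abs_le]
      constructor <;> linarith
    have hMM : ∀ p, |M Q p - M Qstar p| ≤ N := by
      intro p
      rw [hM, hM, ← Finset.sum_sub_distrib]
      refine (Finset.abs_sum_le_sum_abs _ _).trans ?_
      calc _ ≤ ∑ s', P p s' * N := by
            apply Finset.sum_le_sum
            intro s' _
            rw [← mul_sub, abs_mul, abs_of_nonneg (hP0 p s')]
            exact mul_le_mul_of_nonneg_left (hsup s') (hP0 p s')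
        _ = N := by rw [← Finset.sum_mul, hP1, one_mul]
    rw [ge_iff_le, mul_assoc, Finset.sum_mul, Finset.mul_sum, ← Finset.sum_sub_distrib]
    apply Finset.sum_le_sum
    intro p _
    have h0 : Qstar p - R p - γ * M Qstar p = 0 := by
      rw [← hH, hQstar]; rfl
    have h4 : H Q p = (Q p - Qstar p) - γ * (M Q p - M Qstar p) := by
      rw [hH]; linarith
    have h5 : (Q p - Qstar p) * (M Q p - M Qstar p) ≤ |Q p - Qstar p| * N := by
      refine (le_abs_self _).trans ?_
      rw [abs_mul]
      exact mul_le_mul_of_nonneg_left (hMM p) (abs_nonneg _)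
    have h6 := mul_le_mul_of_nonneg_left h5 hγ0
    rw [h4]
    linarith
  refine ⟨key, fun _ Q => ?_⟩
  refine le_trans ?_ (key Q)
  have hE : 0 ≤ ∑ p, (Q p - Qstar p) ^ 2 := Finset.sum_nonneg fun p _ => sq_nonneg _
  have hN : (univ.sup' univ_nonempty fun p => |Q p - Qstar p|) ≤
      Real.sqrt (∑ p, (Q p - Qstar p) ^ 2) := by
    apply Finset.sup'_le
    intro p _
    apply Real.abs_le_sqrt
    exact Finset.single_le_sum (f := fun p => (Q p - Qstar p) ^ 2)
      (fun p _ => sq_nonneg _) (mem_univ p)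
  have hL : (∑ p, |Q p - Qstar p|) ≤ Real.sqrt (Fintype.card S * Fintype.card A) *
      Real.sqrt (∑ p, (Q p - Qstar p) ^ 2) := by
    rw [← Real.sqrt_mul (by positivity)]
    apply Real.le_sqrt_of_sq_le
    have := sq_sum_le_card_mul_sum_sq (s := univ) (f := fun p => |Q p - Qstar p|)
    simpa [Fintype.card_prod] using this
  have hL0 : 0 ≤ ∑ p, |Q p - Qstar p| := Finset.sum_nonneg fun p _ => abs_nonneg _
  have h7 := mul_le_mul_of_nonneg_left hN hL0
  have h8 := mul_le_mul_of_nonneg_right hL (Real.sqrt_nonneg (∑ p, (Q p - Qstar p) ^ 2))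
  rw [mul_assoc, Real.mul_self_sqrt hE] at h8
  have h9 := mul_le_mul_of_nonneg_left (h7.trans h8) hγ0
  linarith
end

section
/- Let G be a d×d real symmetric positive definite matrix, let ‖·‖ denote the operator (spectral) norm, let η > 0 and ρ ∈ (1/2, 1) with η·‖G‖ ≤ 1, and set η_j = η·j^{−ρ}. Then ∑_{t=1}^{∞} ‖ ∏_{j=1}^{t} (I − η_j G) ‖ < ∞. -/
open scoped RealInnerProductSpace

theorem coercive_aux (d : ℕ) (hd : 1 ≤ d)
    (G : EuclideanSpace ℝ (Fin d) →L[ℝ] EuclideanSpace ℝ (Fin d))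
    (hpd : ∀ x : EuclideanSpace ℝ (Fin d), x ≠ 0 → 0 < ⟪G x, x⟫) :
    ∃ c : ℝ, 0 < c ∧ ∀ x : EuclideanSpace ℝ (Fin d), c * ‖x‖ ^ 2 ≤ ⟪G x, x⟫ := by
  have : Nonempty (Fin d) := ⟨⟨0, hd⟩⟩
  have hne : (Metric.sphere (0 : EuclideanSpace ℝ (Fin d)) 1).Nonempty :=
    NormedSpace.sphere_nonempty.mpr zero_le_one
  have hcont : ContinuousOn (fun x : EuclideanSpace ℝ (Fin d) => (⟪G x, x⟫ : ℝ))
      (Metric.sphere 0 1) := by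
    apply Continuous.continuousOn
    fun_prop
  obtain ⟨x0, hx0, hmin⟩ := (isCompact_sphere (0 : EuclideanSpace ℝ (Fin d)) 1).exists_isMinOn
    hne hcont
  have hx0n : ‖x0‖ = 1 := by simpa using hx0
  refine ⟨⟪G x0, x0⟫, hpd x0 (by intro h; simp [h] at hx0n), fun x => ?_⟩
  by_cases hx : x = 0
  · simp [hx]
  have hn : 0 < ‖x‖ := norm_pos_iff.mpr hx
  have hy : (‖x‖⁻¹ • x) ∈ Metric.sphere (0 : EuclideanSpace ℝ (Fin d)) 1 := by
    simp [norm_smul, hn.ne']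
  have h := isMinOn_iff.mp hmin _ hy
  simp only [map_smul, real_inner_smul_left, real_inner_smul_right] at h
  calc _ ≤ (‖x‖⁻¹ * (‖x‖⁻¹ * ⟪G x, x⟫)) * ‖x‖ ^ 2 := by gcongr
    _ = _ := by field_simp

theorem contract_aux (d : ℕ)
    (G : EuclideanSpace ℝ (Fin d) →L[ℝ] EuclideanSpace ℝ (Fin d)) (c s : ℝ)
    (hc : ∀ x : EuclideanSpace ℝ (Fin d), c * ‖x‖ ^ 2 ≤ ⟪G x, x⟫)
    (hs : 0 ≤ s) (h1 : s * ‖G‖ ^ 2 ≤ c) (h2 : s * c / 2 ≤ 1) :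
    ‖1 - s • G‖ ≤ 1 - s * c / 2 := by
  refine ContinuousLinearMap.opNorm_le_bound _ (by linarith) fun x => ?_
  apply le_of_sq_le_sq _ (by have := norm_nonneg x; apply mul_nonneg <;> linarith)
  have e : (1 - s • G) x = x - s • G x := by simp
  rw [e, norm_sub_sq_real, real_inner_smul_right, norm_smul, real_inner_comm]
  have hg : ‖G x‖ ^ 2 ≤ ‖G‖ ^ 2 * ‖x‖ ^ 2 := by
    rw [← mul_pow]; gcongr; exact G.le_opNorm x
  have hx := hc x
  have a1 : s * (c * ‖x‖ ^ 2) ≤ s * ⟪G x, x⟫ := by gcongr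
  have a2 : s ^ 2 * ‖G x‖ ^ 2 ≤ s ^ 2 * (‖G‖ ^ 2 * ‖x‖ ^ 2) := by gcongr
  have a3 : (s * ‖x‖ ^ 2) * (s * ‖G‖ ^ 2) ≤ (s * ‖x‖ ^ 2) * c := by gcongr
  rw [mul_pow, Real.norm_eq_abs, sq_abs]
  nlinarith [sq_nonneg (s * c * ‖x‖)]

theorem summable_aux (u : ℕ → ℝ) (hu : ∀ t, 0 ≤ u t) (N : ℕ)
    (h : ∀ t ≥ N, u (t + 1) ≤ (1 - 2 / ((t : ℝ) + 1)) * u t) : Summable u := by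
  have hb : ∀ t ≥ N, (t : ℝ) ^ 2 * u t ≤ (N : ℝ) ^ 2 * u N := by
    intro t ht
    induction t, ht using Nat.le_induction with
    | base => exact le_rfl
    | succ t ht ih =>
      refine le_trans ?_ ih
      push_cast
      calc ((t : ℝ) + 1) ^ 2 * u (t + 1)
          ≤ ((t : ℝ) + 1) ^ 2 * ((1 - 2 / ((t : ℝ) + 1)) * u t) := by
            gcongr; exact h t ht
        _ = ((t : ℝ) ^ 2 - 1) * u t := by field_simp; ring
        _ ≤ _ := by gcongr; exacts [hu t, by linarith]
  have hs : Summable (fun t : ℕ => ((N : ℝ) ^ 2 * u N) * (1 / (t : ℝ) ^ 2)) :=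
    (Real.summable_one_div_nat_pow.mpr (by norm_num)).mul_left _
  refine summable_of_isBigO_nat hs (Asymptotics.IsBigO.of_bound 1 ?_)
  filter_upwards [Filter.eventually_ge_atTop N, Filter.eventually_gt_atTop 0] with t ht h0
  have h0' : (0 : ℝ) < t := by exact_mod_cast h0
  rw [one_mul, Real.norm_of_nonneg (hu t), Real.norm_of_nonneg (by have := hu N; positivity),
    mul_one_div, le_div_iff₀ (by positivity)]
  linarith [hb t ht]

/-- Claim 1 / inequality (A.1): summability of the operator norms of the
products ∏_{j=1}^{t} (I − η_j G) for a symmetric positive definite G and step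
sizes η_j = η j^{−ρ} with η‖G‖ ≤ 1 and ρ ∈ (1/2, 1). Here
P t = ∏_{j=1}^{t} (I − η_j G) (in decreasing-index order), with P 0 = I. -/
theorem stmt_10 (d : ℕ) (hd : 1 ≤ d)
    (G : EuclideanSpace ℝ (Fin d) →L[ℝ] EuclideanSpace ℝ (Fin d))
    (hG_sym : ∀ x y : EuclideanSpace ℝ (Fin d), ⟪G x, y⟫ = ⟪x, G y⟫)
    (hpd : ∀ x : EuclideanSpace ℝ (Fin d), x ≠ 0 → 0 < ⟪G x, x⟫)
    (η ρ : ℝ) (hη : 0 < η) (hρ1 : 1 / 2 < ρ) (hρ2 : ρ < 1) (hηG : η * ‖G‖ ≤ 1)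
    (ηt : ℕ → ℝ) (hηt : ∀ t : ℕ, ηt t = η * (t : ℝ) ^ (-ρ))
    (P : ℕ → (EuclideanSpace ℝ (Fin d) →L[ℝ] EuclideanSpace ℝ (Fin d)))
    (hP0 : P 0 = 1)
    (hPrec : ∀ t : ℕ, P (t + 1) = (1 - ηt (t + 1) • G) * P t) :
    Summable (fun t : ℕ => ‖P (t + 1)‖) := by
  obtain ⟨c, hc, hco⟩ := coercive_aux d hd G hpd
  refine (summable_nat_add_iff (f := fun t => ‖P t‖) 1).mpr ?_
  have hcast : Filter.Tendsto (fun t : ℕ => ((t + 1 : ℕ) : ℝ)) Filter.atTop Filter.atTop :=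
    tendsto_natCast_atTop_atTop.comp (Filter.tendsto_add_atTop_nat 1)
  have hlim : Filter.Tendsto (fun t : ℕ => ηt (t + 1)) Filter.atTop (nhds 0) := by
    have h := ((tendsto_rpow_neg_atTop (by linarith : 0 < ρ)).comp hcast).const_mul η
    simp only [mul_zero] at h
    exact h.congr fun t => (hηt (t + 1)).symm
  have hbig := ((tendsto_rpow_atTop (by linarith : 0 < 1 - ρ)).comp hcast).eventually_ge_atTop
    (4 / (η * c))
  have e1 := (hlim.mul_const (‖G‖ ^ 2)).eventually_le_const (by simpa using hc)
  have e2 := (hlim.mul_const (c / 2)).eventually_le_const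
    (by simp : (0 : ℝ) * (c / 2) < 1)
  obtain ⟨N, hN⟩ := Filter.eventually_atTop.mp (hbig.and (e1.and e2))
  refine summable_aux _ (fun t => norm_nonneg _) N fun t ht => ?_
  obtain ⟨b, b1, b2⟩ := hN t ht
  have hpos : (0 : ℝ) < ((t + 1 : ℕ) : ℝ) := by positivity
  have hs : 0 ≤ ηt (t + 1) := by rw [hηt]; positivity
  have hk := contract_aux d G c (ηt (t + 1)) hco hs b1 (by linarith)
  rw [hPrec]
  refine (norm_mul_le _ _).trans ?_
  gcongr
  refine hk.trans ?_
  have hmain : 2 / ((t : ℝ) + 1) ≤ ηt (t + 1) * c / 2 := by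
    simp only [Function.comp] at b
    rw [div_le_iff₀ (by positivity)] at b
    rw [div_le_iff₀ (by positivity), hηt]
    have hr : ((t + 1 : ℕ) : ℝ) ^ (1 - ρ) = ((t + 1 : ℕ) : ℝ) ^ (-ρ) * ((t : ℝ) + 1) := by
      rw [sub_eq_neg_add, Real.rpow_add hpos, Real.rpow_one]; push_cast; rfl
    rw [hr] at b
    linarith
  linarith
end

section
/- Let η > 0, ρ ∈ (1/2, 1), and set η_t = η·t^{−ρ} for t ≥ 1. Let c > 0 and K ≥ 0 be constants with c·η ≤ 1, and let (x_t)_{t≥0} be a sequence of nonnegative reals satisfying x_t ≤ (1 − c·η_t)·x_{t−1} + K·η_t² for all t ≥ 1. Then sup_{t≥1} x_t / η_t < ∞; that is, there is a constant K' > 0 with x_t ≤ K'·η_t for all t ≥ 1. -/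
/-- Lemma A.11: the deterministic recursion bound yielding x_t ≤ K'·η_t for
step sizes η_t = η·t^{−ρ} with ρ ∈ (1/2, 1). -/
theorem stmt_15 (η ρ : ℝ) (hη : 0 < η) (hρ1 : 1 / 2 < ρ) (hρ2 : ρ < 1)
    (c K : ℝ) (hc : 0 < c) (hK : 0 ≤ K) (hcη : c * η ≤ 1)
    (x : ℕ → ℝ) (hx_nonneg : ∀ t, 0 ≤ x t)
    (hrec : ∀ t : ℕ, 1 ≤ t →
      x t ≤ (1 - c * (η * (t : ℝ) ^ (-ρ))) * x (t - 1)
        + K * (η * (t : ℝ) ^ (-ρ)) ^ 2) :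
    ∃ K' > 0, ∀ t : ℕ, 1 ≤ t → x t ≤ K' * (η * (t : ℝ) ^ (-ρ)) := by
  have hlim : Filter.Tendsto (fun n : ℕ => (n : ℝ) ^ (1 - ρ)) Filter.atTop Filter.atTop :=
    (tendsto_rpow_atTop (by linarith)).comp tendsto_natCast_atTop_atTop
  obtain ⟨N, hN⟩ := Filter.eventually_atTop.1
    (hlim.eventually (Filter.eventually_ge_atTop (4 / (c * η))))
  have hepos : ∀ t : ℕ, 1 ≤ t → 0 < η * (t : ℝ) ^ (-ρ) := by
    intro t ht
    have : (0 : ℝ) < t := by exact_mod_cast ht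
    positivity
  have hS : ∀ t ∈ Finset.range (N + 2), 0 ≤ x t / (η * (t : ℝ) ^ (-ρ)) := by
    intro t _
    have := hx_nonneg t
    positivity
  set S := ∑ t ∈ Finset.range (N + 2), x t / (η * (t : ℝ) ^ (-ρ)) with hSdef
  have hS0 : 0 ≤ S := Finset.sum_nonneg hS
  have hKc : 0 ≤ 2 * K / c := by positivity
  refine ⟨S + 2 * K / c + 1, by linarith, ?_⟩
  set K' := S + 2 * K / c + 1 with hK'
  intro t ht
  induction t, ht using Nat.le_induction with
  | base =>
    have h1 := Finset.single_le_sum hS (Finset.mem_range.2 (show 1 < N + 2 by omega))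
    rw [← div_le_iff₀ (hepos 1 le_rfl)]
    linarith
  | succ n hn ih =>
    by_cases hnN : n + 1 < N + 2
    · have h1 := Finset.single_le_sum hS (Finset.mem_range.2 hnN)
      rw [← div_le_iff₀ (hepos (n+1) (by omega))]
      linarith
    have hr := hrec (n + 1) (by omega)
    have he := hepos (n + 1) (by omega)
    have hbig := hN (n + 1) (by omega)
    have hn0 : (1 : ℝ) ≤ n := by exact_mod_cast hn
    simp only [Nat.add_sub_cancel] at hr
    push_cast at hr he hbig ⊢
    have hp : (0 : ℝ) < n + 1 := by linarith
    have hpow : ((n : ℝ) + 1) ^ (1 - ρ) = (n + 1) * ((n : ℝ) + 1) ^ (-ρ) := by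
      rw [sub_eq_add_neg, Real.rpow_add hp, Real.rpow_one]
    have hce : 4 ≤ c * (η * ((n : ℝ) + 1) ^ (-ρ)) * (n + 1) := by
      rw [div_le_iff₀ (by positivity), hpow] at hbig
      linarith
    have hle1 : c * (η * ((n : ℝ) + 1) ^ (-ρ)) ≤ 1 := by
      have : ((n : ℝ) + 1) ^ (-ρ) ≤ 1 :=
        Real.rpow_le_one_of_one_le_of_nonpos (by linarith) (by linarith)
      nlinarith [mul_pos hc hη]
    have hratio : η * (n : ℝ) ^ (-ρ) ≤ (η * ((n : ℝ) + 1) ^ (-ρ)) * (1 + 1 / n) := by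
      have hnp : (0 : ℝ) < n := by linarith
      have h1 : (1 + 1 / (n : ℝ)) ^ ρ ≤ 1 + 1 / n := by
        have h2 : (1 : ℝ) ≤ 1 + 1 / n := by
          have : (0 : ℝ) ≤ 1 / n := by positivity
          linarith
        calc _ ≤ (1 + 1 / (n : ℝ)) ^ (1 : ℝ) := Real.rpow_le_rpow_of_exponent_le h2 hρ2.le
          _ = _ := Real.rpow_one _
      have h3 : (n : ℝ) ^ (-ρ) = ((n : ℝ) + 1) ^ (-ρ) * (1 + 1 / (n : ℝ)) ^ ρ := by
        have : (1 + 1 / (n : ℝ)) = (n + 1) / n := by field_simp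
        rw [this, Real.div_rpow hp.le hnp.le, Real.rpow_neg hp.le, Real.rpow_neg hnp.le]
        have := (Real.rpow_pos_of_pos hp ρ).ne'
        field_simp
      rw [h3, mul_assoc]
      gcongr
    set e := η * ((n : ℝ) + 1) ^ (-ρ) with hedef
    have hK'pos : 0 < K' := by linarith
    have hinv : 1 / (n : ℝ) ≤ c * e / 2 := by
      rw [div_le_iff₀ (by linarith)]
      nlinarith [mul_pos hc he]
    have hKK : 2 * K ≤ K' * c := by
      rw [← div_le_iff₀ hc]; linarith
    have hprod : (1 - c * e) * (1 + 1 / (n : ℝ)) ≤ 1 - c * e / 2 := by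
      have : (0 : ℝ) ≤ 1 / n := by positivity
      nlinarith [mul_pos hc he, mul_nonneg (mul_pos hc he).le this]
    calc x (n + 1) ≤ (1 - c * e) * x n + K * e ^ 2 := hr
      _ ≤ (1 - c * e) * (K' * (e * (1 + 1 / n))) + K * e ^ 2 := by
        have h0 : 0 ≤ 1 - c * e := by linarith
        have : x n ≤ K' * (e * (1 + 1 / n)) :=
          ih.trans (mul_le_mul_of_nonneg_left hratio hK'pos.le)
        gcongr
      _ = K' * e * ((1 - c * e) * (1 + 1 / n)) + K * e ^ 2 := by ring
      _ ≤ K' * e * (1 - c * e / 2) + K * e ^ 2 := by gcongr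
      _ = K' * e - (K' * c - 2 * K) * e ^ 2 / 2 := by ring
      _ ≤ K' * e := by
        have : 0 ≤ (K' * c - 2 * K) * e ^ 2 := mul_nonneg (by linarith) (sq_nonneg e)
        linarith
end
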